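/- Let Δ be a quasi-tree of dimension d−1 on [n] and let 2 ≤ ℓ ≤ d−1. Let I_1 = I(\overline{skel_Δ(1)}) be the ideal generated by the monomials x_i x_j with {i,j} ∉ Δ, and I_ℓ = I(\overline{skel_Δ(ℓ)}) the ideal generated by the monomials x_F with F ⊆ [n], |F| = ℓ+1, F ∉ Δ. Then I_ℓ is generated by the set of all squarefree monomials of degree ℓ+1 that are divisible by some minimal monomial generator of I_1; equivalently, an (ℓ+1)-element subset F of [n] is a nonface of Δ if and only if some 2-element subset of F is a nonface of Δ. -/

import Mathlib

open Finset

/-- A simplicial complex on the vertex set `Fin n`: contains all singletons and is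
closed under taking subsets. -/
def IsComplex {n : ℕ} (Δ : Set (Finset (Fin n))) : Prop :=
  (∀ i : Fin n, {i} ∈ Δ) ∧ ∀ F ∈ Δ, ∀ G ⊆ F, G ∈ Δ

/-- Closed under taking subsets (a simplicial complex, singletons not required). -/
def IsLowerComplex {n : ℕ} (Δ : Set (Finset (Fin n))) : Prop :=
  ∀ F ∈ Δ, ∀ G ⊆ F, G ∈ Δ

/-- The set of facets (maximal faces) of `Δ`. -/
def facets {n : ℕ} (Δ : Set (Finset (Fin n))) : Set (Finset (Fin n)) :=
  {F | F ∈ Δ ∧ ∀ G ∈ Δ, F ⊆ G → F = G}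

/-- The simplicial complex generated by a family of subsets of `Fin n`. -/
def gen {n : ℕ} (S : Set (Finset (Fin n))) : Set (Finset (Fin n)) :=
  {G | ∃ F ∈ S, G ⊆ F}

/-- `F` is a leaf of `Δ`: either `F` is the only facet, or there is a facet `G ≠ F`
(a branch of `F`) with `H ∩ F ⊆ G ∩ F` for every facet `H ≠ F`. -/
def IsLeaf {n : ℕ} (Δ : Set (Finset (Fin n))) (F : Finset (Fin n)) : Prop :=
  F ∈ facets Δ ∧
    (facets Δ = {F} ∨ ∃ G ∈ facets Δ, G ≠ F ∧ ∀ H ∈ facets Δ, H ≠ F → H ∩ F ⊆ G ∩ F)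

/-- `Δ` is a quasi-tree: there is a labeling `F₁, …, F_m` of its facets such that `F_i`
is a leaf of `⟨F₁, …, F_i⟩` for every `i` (a leaf order). -/
def IsQuasiTree {n : ℕ} (Δ : Set (Finset (Fin n))) : Prop :=
  ∃ L : List (Finset (Fin n)), L.Nodup ∧ {F | F ∈ L} = facets Δ ∧
    ∀ i : Fin L.length, IsLeaf (gen {F | F ∈ L.take (i.1 + 1)}) (L.get i)

/-- `Δ` is pure: all facets have the same cardinality. -/
def IsPure {n : ℕ} (Δ : Set (Finset (Fin n))) : Prop :=
  ∀ F ∈ facets Δ, ∀ G ∈ facets Δ, F.card = G.card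

/-- `Δ` is shellable: it is pure and there is an order `F₁, …, F_m` of its facets such
that for all `j < i` and `x ∈ F_i \ F_j` there is `k < i` with `F_i \ F_k = {x}`. -/
def IsShellable {n : ℕ} (Δ : Set (Finset (Fin n))) : Prop :=
  IsPure Δ ∧ ∃ L : List (Finset (Fin n)), L.Nodup ∧ {F | F ∈ L} = facets Δ ∧
    ∀ i j : Fin L.length, j < i →
      ∀ x ∈ L.get i \ L.get j, ∃ k : Fin L.length, k < i ∧ L.get i \ L.get k = {x}

/-- The `i`-skeleton of `Δ`: the complex generated by the faces of dimension `i`. -/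
def skel {n : ℕ} (Δ : Set (Finset (Fin n))) (i : ℕ) : Set (Finset (Fin n)) :=
  gen {F | F ∈ Δ ∧ F.card = i + 1}

/-- The Alexander dual of `Δ`: `Δ^∨ = {[n] \ F : F ∉ Δ}`. -/
def dual {n : ℕ} (Δ : Set (Finset (Fin n))) : Set (Finset (Fin n)) :=
  {G | Gᶜ ∉ Δ}

/-- `Δ^c`, the complex generated by the complements of the facets of `Δ`. -/
def complements {n : ℕ} (Δ : Set (Finset (Fin n))) : Set (Finset (Fin n)) :=
  gen ((·ᶜ) '' facets Δ)

/-- `Δ` is flag: every minimal nonface has exactly two elements. -/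
def IsFlag {n : ℕ} (Δ : Set (Finset (Fin n))) : Prop :=
  ∀ F : Finset (Fin n), F ∉ Δ → (∀ G ⊂ F, G ∈ Δ) → F.card = 2

/-- The squarefree monomial `x_F = ∏_{i ∈ F} x_i`. -/
noncomputable def xF {n : ℕ} (K : Type) [Field K] (F : Finset (Fin n)) :
    MvPolynomial (Fin n) K := ∏ i ∈ F, MvPolynomial.X i

/-- The Stanley–Reisner ideal of `Δ`, generated by the monomials `x_F` with `F` a
nonface of `Δ`. -/
noncomputable def SRIdeal {n : ℕ} (K : Type) [Field K] (Δ : Set (Finset (Fin n))) :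
    Ideal (MvPolynomial (Fin n) K) := Ideal.span (xF K '' {F | F ∉ Δ})

/-- The facet ideal of `Δ`, generated by the monomials `x_F` with `F` a facet of `Δ`. -/
noncomputable def facetIdeal {n : ℕ} (K : Type) [Field K] (Δ : Set (Finset (Fin n))) :
    Ideal (MvPolynomial (Fin n) K) := Ideal.span (xF K '' facets Δ)

/-- A set `G` of monomials (assumed to be the minimal monomial generating set of the
ideal it generates) has linear quotients: there is an order `f₁, …, f_m` of `G` such
that each colon ideal `(f₁,…,f_{i-1}) : f_i` is generated by a set of variables. -/
def HasLinearQuotients {n : ℕ} (K : Type) [Field K]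
    (G : Set (MvPolynomial (Fin n) K)) : Prop :=
  ∃ L : List (MvPolynomial (Fin n) K), L.Nodup ∧ {f | f ∈ L} = G ∧
    ∀ i : Fin L.length, 0 < i.1 →
      ∃ V : Set (Fin n),
        Submodule.colon (Ideal.span {f | f ∈ L.take i.1}) (Ideal.span {L.get i}) =
          Ideal.span (MvPolynomial.X '' V)

/-- The clique complex `Δ(G)` of a graph `G`: faces are the cliques of `G`. -/
def cliqueComplex {n : ℕ} (G : SimpleGraph (Fin n)) : Set (Finset (Fin n)) :=
  {F | ∀ i ∈ F, ∀ j ∈ F, i ≠ j → G.Adj i j}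

/-- A graph is chordal if every cycle of length at least 4 has a chord, i.e. an edge of
the graph joining two vertices of the cycle which is not an edge of the cycle. -/
def IsChordalGraph {V : Type} (G : SimpleGraph V) : Prop :=
  ∀ (v : V) (c : G.Walk v v), c.IsCycle → 4 ≤ c.length →
    ∃ x y, G.Adj x y ∧ x ∈ c.support ∧ y ∈ c.support ∧ s(x, y) ∉ c.edges

/-- A module `M` over `S` has projective dimension at most one: some (equivalently, by
Schanuel's lemma, any) presentation of `M` by a free module has projective kernel. -/
def ProjDimLEOne (S : Type) [CommRing S] (M : Type) [AddCommGroup M] [Module S M] : Prop :=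
  ∃ (ι : Type) (f : (ι →₀ S) →ₗ[S] M), Function.Surjective f ∧
    Module.Projective S (LinearMap.ker f)

/-- The monomial with exponent vector `a`. -/
noncomputable def mono {n : ℕ} (K : Type) [Field K] (a : Fin n → ℕ) :
    MvPolynomial (Fin n) K := MvPolynomial.monomial (Finsupp.equivFunOnFinite.symm a) 1

/-- The Taylor relation `r_{ij} = u_{ji} e_i - u_{ij} e_j` for the monomials with
exponent vectors `a i`, `a j`, where `u_{ij} = u_i / gcd(u_i, u_j)`. -/
noncomputable def taylorRel {n t : ℕ} (K : Type) [Field K] (a : Fin t → Fin n → ℕ)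
    (i j : Fin t) : Fin t → MvPolynomial (Fin n) K :=
  Pi.single i (mono K (a j - a i ⊓ a j)) - Pi.single j (mono K (a i - a i ⊓ a j))

/-- Every face is contained in a facet. -/
theorem exists_subset_facet {n : ℕ} {Δ : Set (Finset (Fin n))} {F : Finset (Fin n)}
    (hF : F ∈ Δ) : ∃ G ∈ facets Δ, F ⊆ G := by
  obtain ⟨G, hFG, hG⟩ := Δ.toFinite.exists_le_maximal hF
  exact ⟨G, ⟨hG.prop, fun H hH hGH => hGH.antisymm (hG.le_of_ge hH hGH)⟩, hFG⟩

theorem subset_gen {n : ℕ} (S : Set (Finset (Fin n))) : S ⊆ gen S :=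
  fun F hF => ⟨F, hF, Subset.rfl⟩

theorem facets_gen_subset {n : ℕ} (S : Set (Finset (Fin n))) : facets (gen S) ⊆ S := by
  rintro F ⟨⟨G, hG, hFG⟩, hmax⟩
  rwa [hmax G (subset_gen S hG) hFG]

/-- Adding a leaf `A` to a family: a set not contained in `A` all of whose pairs are covered
by `insert A S` already has all its pairs covered by `S`. -/
theorem IsLeaf.pairs_covered {n : ℕ} {S : Set (Finset (Fin n))} {A F : Finset (Fin n)}
    (hA : IsLeaf (gen (insert A S)) A) (hFA : ¬ F ⊆ A)
    (hF : ∀ x ∈ F, ∀ y ∈ F, ∃ H ∈ insert A S, x ∈ H ∧ y ∈ H) :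
    ∀ x ∈ F, ∀ y ∈ F, ∃ H ∈ S, x ∈ H ∧ y ∈ H := by
  obtain ⟨v, hvF, hvA⟩ := not_subset.mp hFA
  have facet_of_mem (x) (hx : x ∈ F) :
      ∃ H ∈ facets (gen (insert A S)), H ≠ A ∧ x ∈ H := by
    obtain ⟨H, hH, hxH, hvH⟩ := hF x hx v hvF
    obtain ⟨H', hH', hHH'⟩ := exists_subset_facet (subset_gen _ hH)
    refine ⟨H', hH', ?_, hHH' hxH⟩
    rintro rfl
    exact hvA (hHH' hvH)
  rcases hA.2 with hA' | ⟨G, hG, hGA, hbranch⟩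
  · obtain ⟨H, hH, hHA, -⟩ := facet_of_mem v hvF
    rw [hA'] at hH
    exact absurd hH hHA
  · intro x hx y hy
    obtain ⟨H, rfl | hH, hxH, hyH⟩ := hF x hx y hy
    · have mem_branch (z) (hz : z ∈ F) (hzH : z ∈ H) : z ∈ G := by
        obtain ⟨E, hE, hEH, hzE⟩ := facet_of_mem z hz
        exact (mem_inter.mp (hbranch E hE hEH (mem_inter.mpr ⟨hzE, hzH⟩))).1
      exact ⟨G, (facets_gen_subset _ hG).resolve_left hGA, mem_branch x hx hxH,
        mem_branch y hy hyH⟩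
    · exact ⟨H, hH, hxH, hyH⟩

/-- A nonempty set whose pairs are covered by an initial segment of a leaf order is contained
in a member of that segment. -/
theorem exists_superset_of_pairs_covered {n : ℕ} {L : List (Finset (Fin n))}
    (hL : ∀ i : Fin L.length, IsLeaf (gen {F | F ∈ L.take (i.1 + 1)}) (L.get i))
    {F : Finset (Fin n)} (hne : F.Nonempty) {k : ℕ} (hk : k ≤ L.length)
    (hF : ∀ x ∈ F, ∀ y ∈ F, ∃ H ∈ L.take k, x ∈ H ∧ y ∈ H) :
    ∃ H ∈ L.take k, F ⊆ H := by
  induction k with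
  | zero =>
    obtain ⟨v, hv⟩ := hne
    simpa using hF v hv v hv
  | succ k ih =>
    have htake : {H | H ∈ L.take (k + 1)} = insert (L.get ⟨k, hk⟩) {H | H ∈ L.take k} := by
      ext H
      rw [Set.mem_ofPred_eq, List.take_succ_eq_append_getElem hk, List.mem_append,
        List.mem_singleton, or_comm]
      rfl
    have hleaf := hL ⟨k, hk⟩
    change ∀ x ∈ F, ∀ y ∈ F, ∃ H ∈ {H | H ∈ L.take (k + 1)}, x ∈ H ∧ y ∈ H at hF
    change ∃ H ∈ {H | H ∈ L.take (k + 1)}, F ⊆ H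
    rw [htake] at hleaf hF ⊢
    by_cases hFA : F ⊆ L.get ⟨k, hk⟩
    · exact ⟨_, Set.mem_insert _ _, hFA⟩
    · obtain ⟨H, hH, hFH⟩ := ih (by omega) (hleaf.pairs_covered hFA hF)
      exact ⟨H, Set.mem_insert_of_mem _ hH, hFH⟩

/-- In a quasi-tree, a nonempty set of vertices all of whose pairs are faces is a face. -/
theorem IsQuasiTree.mem_of_pairs_mem {n : ℕ} {Δ : Set (Finset (Fin n))} (hΔ : IsLowerComplex Δ)
    (hq : IsQuasiTree Δ) {F : Finset (Fin n)} (hne : F.Nonempty)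
    (hF : ∀ x ∈ F, ∀ y ∈ F, {x, y} ∈ Δ) : F ∈ Δ := by
  obtain ⟨L, -, hLfacets, hL⟩ := hq
  have mem_iff (H : Finset (Fin n)) : H ∈ L ↔ H ∈ facets Δ := Set.ext_iff.mp hLfacets H
  obtain ⟨H, hH, hFH⟩ := exists_superset_of_pairs_covered hL hne le_rfl fun x hx y hy => by
    obtain ⟨H, hH, hxy⟩ := exists_subset_facet (hF x hx y hy)
    exact ⟨H, by simpa [mem_iff] using hH, hxy (by simp), hxy (by simp)⟩
  rw [List.take_length, mem_iff] at hH
  exact hΔ H hH.1 F hFH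

/-- Let `Δ` be a quasi-tree of dimension `d - 1` on `[n]` and
`2 ≤ ℓ ≤ d - 1`.  Then `I(\overline{skel_Δ(ℓ)})` is generated by the squarefree
monomials of degree `ℓ + 1` divisible by a minimal generator of
`I(\overline{skel_Δ(1)})`; equivalently, an `(ℓ+1)`-element subset `F` of `[n]` is a
nonface of `Δ` if and only if some 2-element subset of `F` is a nonface of `Δ`. -/
theorem stmt_18 {n d ℓ : ℕ} (Δ : Set (Finset (Fin n))) (hΔ : IsComplex Δ)
    (hq : IsQuasiTree Δ)
    (hdim : ∀ F ∈ Δ, F.card ≤ d) (hdim' : ∃ F ∈ Δ, F.card = d)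
    (hl1 : 2 ≤ ℓ) (hl2 : ℓ + 1 ≤ d) :
    ∀ F : Finset (Fin n), F.card = ℓ + 1 →
      (F ∉ Δ ↔ ∃ G ⊆ F, G.card = 2 ∧ G ∉ Δ) := by
  intro F hcard
  refine ⟨fun hF => ?_, fun ⟨G, hGF, _, hG⟩ hF => hG (hΔ.2 F hF G hGF)⟩
  by_contra! hpairs
  refine hF (hq.mem_of_pairs_mem hΔ.2 (card_pos.mp (by omega)) fun x hx y hy => ?_)
  rcases eq_or_ne x y with rfl | hxy
  · simpa using hΔ.1 x
  · exact hpairs _ (by simp [insert_subset_iff, hx, hy]) (card_pair hxy)
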